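/- Let K = k̄(F) and H = stab(I(F,ν)). Then F · H(K) = V_K(I(F,ν)), i.e. the K-points of the zero set of I(F,ν) in GL_n(K) form exactly the left coset of H(K) by the fundamental matrix F. -/

import Mathlib

open MvPolynomial Matrix

noncomputable section

/-- The `n × n` matrix of indeterminates `X = (X_{i,j})` over a field `K`. -/
def matX (K : Type) [Field K] (n : ℕ) :
    Matrix (Fin n) (Fin n) (MvPolynomial (Fin n × Fin n) K) :=
  Matrix.of fun i j => X (i, j)

/-- The ring `K[X, 1/det(X)]`. -/
abbrev GLRing (K : Type) [Field K] (n : ℕ) := Localization.Away (matX K n).det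

/-- The image of the matrix of indeterminates in `K[X, 1/det(X)]`. -/
def XX (K : Type) [Field K] (n : ℕ) : Matrix (Fin n) (Fin n) (GLRing K n) :=
  (matX K n).map (algebraMap _ _)

/-- The ideal `I(F,ν)` of `K[X,1/det(X)]` generated by the polynomials of total degree
at most `ν` vanishing at the fundamental matrix (encoded by the evaluation map `ev`). -/
def Ifv {K : Type} [Field K] {n : ℕ} {S : Type} [CommRing S]
    (ev : GLRing K n → S) (ν : ℕ) : Ideal (GLRing K n) :=
  Ideal.span {q | ∃ P : MvPolynomial (Fin n × Fin n) K, P.totalDegree ≤ ν ∧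
    ev (algebraMap (MvPolynomial (Fin n × Fin n) K) (GLRing K n) P) = 0 ∧
    q = algebraMap (MvPolynomial (Fin n × Fin n) K) (GLRing K n) P}

/-- The stabilizer `stab(I) = {g : ∀ P ∈ I, P(Xg) ∈ I}` of an ideal `I`, where
`σ g` is the substitution `P(X) ↦ P(Xg)`. -/
def stab {G R : Type} [CommRing R] (σ : G → R → R) (I : Ideal R) : Set G :=
  {g | ∀ P ∈ I, σ g P ∈ I}

/-- The `K`-points of a subset `H` of `GL_n(C)`: the invertible matrices over `K`
satisfying every polynomial equation (with coefficients in `C`) satisfied by all of `H`. -/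
def pts (C : Type) [Field C] (K : Type) [Field K] [Algebra C K] (n : ℕ)
    (H : Set (GL (Fin n) C)) : Set (GL (Fin n) K) :=
  {M | ∀ P : MvPolynomial (Fin n × Fin n) C,
    (∀ h ∈ H, MvPolynomial.eval (fun p => (h : Matrix (Fin n) (Fin n) C) p.1 p.2) P = 0) →
    MvPolynomial.aeval (fun p => (M : Matrix (Fin n) (Fin n) K) p.1 p.2) P = 0}

/-- The zero set `V_K(I)` of an ideal `I` of `k[X,1/det(X)]` inside `GL_n(K)`, where
`evK M` is evaluation `P(X) ↦ P(M)`. -/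
def zeroSet {k K : Type} [Field k] [Field K] {n : ℕ}
    (evK : GL (Fin n) K → (GLRing k n → K)) (I : Ideal (GLRing k n)) :
    Set (GL (Fin n) K) :=
  {M | ∀ P ∈ I, evK M P = 0}

namespace MvPolynomial

variable {C₀ k S T σ : Type*} [Field C₀] [Field k] [CommRing S] [CommRing T]

/-- A property of pairs (degree bound, polynomial) that holds for constants and variables and is
compatible with sums, products and weakening of the bound holds for every polynomial. -/
theorem totalDegree_bound_induction {R : Type*} [CommSemiring R] {Q : ℕ → MvPolynomial σ R → Prop}
    (hC : ∀ a, Q 0 (C a)) (hX : ∀ i, Q 1 (X i))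
    (hadd : ∀ d p q, Q d p → Q d q → Q d (p + q))
    (hmul : ∀ d e p q, Q d p → Q e q → Q (d + e) (p * q))
    (hmono : ∀ d e p, d ≤ e → Q d p → Q e p) {d : ℕ} (p : MvPolynomial σ R)
    (hp : p.totalDegree ≤ d) : Q d p := by
  classical
  refine hmono _ _ _ hp ?_
  have hpow : ∀ i m, Q m (X i ^ m) := by
    intro i m
    induction m with
    | zero => simpa using hC 1
    | succ m ih => rw [pow_succ]; exact hmul _ _ _ _ ih (hX i)
  have hprod : ∀ (m : σ →₀ ℕ) (s : Finset σ), Q (∑ i ∈ s, m i) (∏ i ∈ s, X i ^ m i) := by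
    intro m s
    induction s using Finset.induction_on with
    | empty => simpa using hC 1
    | insert i s hi ih =>
      rw [Finset.sum_insert hi, Finset.prod_insert hi]
      exact hmul _ _ _ _ (hpow _ _) ih
  have hsum : ∀ s : Finset (σ →₀ ℕ), s ⊆ p.support →
      Q p.totalDegree (∑ m ∈ s, monomial m (p.coeff m)) := by
    intro s
    induction s using Finset.induction_on with
    | empty =>
      intro _
      simpa using hmono 0 p.totalDegree _ (Nat.zero_le _) (hC 0)
    | insert m s hm ih =>
      intro hs
      rw [Finset.sum_insert hm]
      refine hadd _ _ _ ?_ (ih fun x hx => hs (Finset.mem_insert_of_mem hx))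
      rw [monomial_eq]
      refine hmono (0 + ∑ i ∈ m.support, m i) _ _ ?_ (hmul _ _ _ _ (hC _) (hprod m m.support))
      rw [zero_add]
      exact le_totalDegree (hs (Finset.mem_insert_self _ _))
  rw [p.as_sum]
  convert hsum p.support subset_rfl using 2
  rw [← p.as_sum]

/-- A substitution of polynomials of degree at most one does not raise the degree. -/
theorem totalDegree_aeval_le_of_le_one {τ R : Type*} [CommSemiring R] {f : σ → MvPolynomial τ R}
    (hf : ∀ i, (f i).totalDegree ≤ 1) {d : ℕ} (p : MvPolynomial σ R) (hp : p.totalDegree ≤ d) :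
    (aeval f p).totalDegree ≤ d := by
  refine totalDegree_bound_induction (Q := fun d p => (aeval f p).totalDegree ≤ d)
    (fun a => ?_) (fun i => ?_) (fun d p q hp hq => ?_) (fun d e p q hp hq => ?_)
    (fun d e p hde hp => hp.trans hde) p hp
  · simp [algebraMap_eq]
  · simpa using hf i
  · rw [map_add]; exact (totalDegree_add _ _).trans (max_le hp hq)
  · rw [map_mul]; exact (totalDegree_mul _ _).trans (add_le_add hp hq)

/-- A submodule of `S[Y]` stable under a derivation of `S` acting on the coefficients is generated
by polynomials with constant coefficients, if `S` is differentially simple. -/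
theorem mem_span_constants_of_coeff_derivation [Algebra C₀ S] (dS : Derivation C₀ S S)
    (hsimple : ∀ J : Ideal S, J ≠ ⊤ → (∀ x ∈ J, dS x ∈ J) → J = ⊥)
    (hconst : ∀ s : S, dS s = 0 → ∃ c : C₀, s = algebraMap C₀ S c)
    (D : Submodule S (MvPolynomial σ S))
    (hD : ∀ v ∈ D, ∃ w ∈ D, ∀ m, coeff m w = dS (coeff m v))
    (v : MvPolynomial σ S) (hv : v ∈ D) :
    v ∈ Submodule.span S {u | u ∈ D ∧ ∃ q : MvPolynomial σ C₀, map (algebraMap C₀ S) q = u} := by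
  classical
  induction hN : v.support.card using Nat.strong_induction_on generalizing v with
  | _ N ih =>
    by_cases hv0 : v = 0
    · rw [hv0]; exact Submodule.zero_mem _
    let E : Set ℕ := {d | ∃ u ∈ D, u ≠ 0 ∧ u.support ⊆ v.support ∧ u.support.card = d}
    have hE : E.Nonempty := ⟨_, v, hv, hv0, subset_rfl, rfl⟩
    obtain ⟨u, huD, hu0, huv, hucard⟩ := Nat.sInf_mem hE
    have hmin : ∀ w ∈ D, w.support ⊆ v.support → w.support.card < u.support.card → w = 0 := by
      intro w hw hws hlt
      by_contra hw0
      exact absurd (Nat.sInf_le (s := E) ⟨w, hw, hw0, hws, rfl⟩) (by omega)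
    obtain ⟨b, hb⟩ := support_nonempty.mpr hu0
    let J : Ideal S :=
      { carrier := {s | ∃ x ∈ D, x.support ⊆ u.support ∧ coeff b x = s}
        add_mem' := by
          rintro _ _ ⟨x, hx, hxs, rfl⟩ ⟨y, hy, hys, rfl⟩
          exact ⟨x + y, D.add_mem hx hy, support_add.trans (Finset.union_subset hxs hys),
            coeff_add _ _ _⟩
        zero_mem' := ⟨0, D.zero_mem, by simp, by simp⟩
        smul_mem' := by
          rintro s _ ⟨x, hx, hxs, rfl⟩
          exact ⟨s • x, D.smul_mem _ hx, support_smul.trans hxs, coeff_smul _ _ _⟩ }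
    have hderiv_support : ∀ x w : MvPolynomial σ S, (∀ m, coeff m w = dS (coeff m x)) →
        w.support ⊆ x.support := by
      intro x w hw m hm
      rw [mem_support_iff] at hm ⊢
      intro h
      exact hm (by rw [hw, h, map_zero])
    have hJtop : J = ⊤ := by
      by_contra hJ
      have hbot := hsimple J hJ (by
        rintro _ ⟨x, hx, hxs, rfl⟩
        obtain ⟨w, hw, hwx⟩ := hD x hx
        exact ⟨w, hw, (hderiv_support x w hwx).trans hxs, hwx b⟩)
      have hmem : coeff b u ∈ J := ⟨u, huD, subset_rfl, rfl⟩
      rw [hbot, Ideal.mem_bot] at hmem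
      exact mem_support_iff.mp hb hmem
    obtain ⟨x, hx, hxs, hxb⟩ : (1 : S) ∈ J := by rw [hJtop]; trivial
    obtain ⟨w, hw, hwx⟩ := hD x hx
    have hws := (hderiv_support x w hwx).trans hxs
    have hw0 : w = 0 := by
      refine hmin w hw (hws.trans huv) (Finset.card_lt_card ?_)
      refine (Finset.ssubset_iff_of_subset hws).mpr ⟨b, hb, ?_⟩
      rw [notMem_support_iff, hwx, hxb, Derivation.map_one_eq_zero]
    have hxC : x ∈ Set.range (map (algebraMap C₀ S)) := by
      rw [mem_range_map_iff_coeffs_subset]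
      intro s hs
      obtain ⟨m, -, rfl⟩ := mem_coeffs_iff.mp hs
      obtain ⟨c, hc⟩ := hconst (coeff m x) (by rw [← hwx, hw0, coeff_zero])
      exact ⟨c, hc.symm⟩
    have hsub : v - coeff b v • x ∈ D := D.sub_mem hv (D.smul_mem _ hx)
    have hlt : (v - coeff b v • x).support.card < N := by
      rw [← hN]
      refine Finset.card_lt_card ?_
      refine (Finset.ssubset_iff_of_subset ?_).mpr ⟨b, huv hb, ?_⟩
      · intro m hm
        by_contra hmv
        have h1 : coeff m v = 0 := notMem_support_iff.mp hmv
        have h2 : coeff m x = 0 := notMem_support_iff.mp fun h => hmv (huv (hxs h))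
        exact mem_support_iff.mp hm (by rw [coeff_sub, coeff_smul, h1, h2, smul_zero, sub_zero])
      · rw [notMem_support_iff, coeff_sub, coeff_smul, hxb, smul_eq_mul, mul_one, sub_self]
    have h := ih _ hlt _ hsub rfl
    rw [← sub_add_cancel v (coeff b v • x)]
    exact Submodule.add_mem _ h (Submodule.smul_mem _ _ (Submodule.subset_span ⟨hx, hxC⟩))

/-- The substitution `P(X) ↦ P(FY)` from `k[X]` to `S[Y]`. -/
def substMatrix {n : ℕ} [Algebra k S] (F : Matrix (Fin n) (Fin n) S) :
    MvPolynomial (Fin n × Fin n) k →ₐ[k] MvPolynomial (Fin n × Fin n) S :=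
  aeval fun p => ∑ l, C (F p.1 l) * X (l, p.2)

theorem eval₂_substMatrix {n : ℕ} [Algebra k S] [Algebra k T] (F : Matrix (Fin n) (Fin n) S)
    (e : S →ₐ[k] T) (N : Matrix (Fin n) (Fin n) T) (P : MvPolynomial (Fin n × Fin n) k) :
    eval₂ (e : S →+* T) (fun p => N p.1 p.2) (substMatrix F P)
      = aeval (fun p => (F.map e * N) p.1 p.2) P := by
  induction P using MvPolynomial.induction_on with
  | C a =>
    rw [← algebraMap_eq, AlgHom.commutes, AlgHom.commutes, IsScalarTower.algebraMap_apply k S,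
      algebraMap_eq, eval₂_C]
    exact e.commutes a
  | add p q hp hq => rw [map_add, map_add, eval₂_add, hp, hq]
  | mul_X p i hp =>
    rw [map_mul, map_mul, eval₂_mul, hp, substMatrix, aeval_X, aeval_X]
    simp [eval₂_sum, Matrix.mul_apply]

/-- The derivation with `δ(X) = AX` preserves degree bounds, and is carried by `P(X) ↦ P(FY)` to
the derivation of the coefficients, when `δ(F) = AF`. -/
theorem exists_derivative_substMatrix {n : ℕ} [Algebra C₀ k] [Algebra k S] [Algebra C₀ S]
    (dk : Derivation C₀ k k) (dS : Derivation C₀ S S)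
    (hdSk : ∀ a : k, dS (algebraMap k S a) = algebraMap k S (dk a))
    (A : Matrix (Fin n) (Fin n) k) (F : Matrix (Fin n) (Fin n) S)
    (hdF : ∀ i j, dS (F i j) = (A.map (algebraMap k S) * F) i j)
    {d : ℕ} (P : MvPolynomial (Fin n × Fin n) k) (hP : P.totalDegree ≤ d) :
    ∃ P' : MvPolynomial (Fin n × Fin n) k, P'.totalDegree ≤ d ∧
      aeval (fun p => F p.1 p.2) P' = dS (aeval (fun p => F p.1 p.2) P) ∧
      ∀ m, coeff m (substMatrix F P') = dS (coeff m (substMatrix F P)) := by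
  classical
  let Q : ℕ → MvPolynomial (Fin n × Fin n) k → Prop := fun d P => P.totalDegree ≤ d ∧
    ∃ P' : MvPolynomial (Fin n × Fin n) k, P'.totalDegree ≤ d ∧
      aeval (fun p => F p.1 p.2) P' = dS (aeval (fun p => F p.1 p.2) P) ∧
      ∀ m, coeff m (substMatrix F P') = dS (coeff m (substMatrix F P))
  suffices h : Q d P from h.2
  refine totalDegree_bound_induction (Q := Q) ?hC ?hX ?hadd ?hmul ?hmono P hP
  case hC =>
    intro a
    refine ⟨by simp, C (dk a), by simp, by simp [hdSk], fun m => ?_⟩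
    have h : ∀ b : k, substMatrix F (C b) = C (algebraMap k S b) := by
      intro b
      rw [← algebraMap_eq, AlgHom.commutes, IsScalarTower.algebraMap_apply k S, algebraMap_eq]
    rw [h, h, coeff_C, coeff_C]
    split_ifs <;> simp [hdSk]
  case hX =>
    intro p
    refine ⟨(totalDegree_X p).le, ∑ l, C (A p.1 l) * X (l, p.2), ?_, ?_, ?_⟩
    · refine totalDegree_finsetSum_le fun l _ => (totalDegree_mul _ _).trans ?_
      rw [totalDegree_C, totalDegree_X]
    · simp [hdF, Matrix.mul_apply]
    · intro m
      have h : substMatrix F (∑ l, C (A p.1 l) * X (l, p.2) : MvPolynomial (Fin n × Fin n) k)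
          = ∑ l, C (dS (F p.1 l)) * X (l, p.2) := by
        simp only [map_sum, map_mul, hdF, Matrix.mul_apply, substMatrix, aeval_X, aeval_C,
          Finset.mul_sum, Finset.sum_mul, Matrix.map_apply]
        rw [Finset.sum_comm]
        refine Finset.sum_congr rfl fun l _ => Finset.sum_congr rfl fun i _ => ?_
        rw [IsScalarTower.algebraMap_apply k S (MvPolynomial _ S), algebraMap_eq, mul_assoc]
      rw [h, substMatrix, aeval_X, coeff_sum, coeff_sum, map_sum]
      refine Finset.sum_congr rfl fun l _ => ?_
      rw [coeff_C_mul, coeff_C_mul, coeff_X]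
      split_ifs <;> simp
  case hadd =>
    intro d p q hp hq
    obtain ⟨hp, p', hp1, hp2, hp3⟩ := hp
    obtain ⟨hq, q', hq1, hq2, hq3⟩ := hq
    exact ⟨(totalDegree_add _ _).trans (max_le hp hq), p' + q',
      (totalDegree_add _ _).trans (max_le hp1 hq1), by simp [hp2, hq2], by simp [hp3, hq3]⟩
  case hmul =>
    intro d e p q hp hq
    obtain ⟨hp, p', hp1, hp2, hp3⟩ := hp
    obtain ⟨hq, q', hq1, hq2, hq3⟩ := hq
    refine ⟨(totalDegree_mul _ _).trans (add_le_add hp hq), p * q' + p' * q,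
      (totalDegree_add _ _).trans (max_le ((totalDegree_mul _ _).trans (add_le_add hp hq1))
        ((totalDegree_mul _ _).trans (add_le_add hp1 hq))), ?_, fun m => ?_⟩
    · simp only [map_add, map_mul, hp2, hq2, Derivation.leibniz, smul_eq_mul]
      ring
    · simp only [map_add, map_mul, coeff_add, coeff_mul, map_sum, hp3, hq3, Derivation.leibniz,
        smul_eq_mul, ← Finset.sum_add_distrib]
      exact Finset.sum_congr rfl fun x _ => by ring
  case hmono =>
    intro d e p hde hp
    obtain ⟨hp, p', hp1, hp2⟩ := hp
    exact ⟨hp.trans hde, p', hp1.trans hde, hp2⟩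

/-- The `S`-module generated by the polynomials `P(FY)`, for `P` of degree at most `ν` vanishing
at `F`. -/
def relationModule (k : Type*) [Field k] {n : ℕ} [Algebra k S] (F : Matrix (Fin n) (Fin n) S)
    (ν : ℕ) : Submodule S (MvPolynomial (Fin n × Fin n) S) :=
  Submodule.span S (substMatrix F ''
    {P : MvPolynomial (Fin n × Fin n) k | P.totalDegree ≤ ν ∧ aeval (fun p => F p.1 p.2) P = 0})

theorem relationModule_derivation_stable {n : ℕ} [Algebra C₀ k] [Algebra k S] [Algebra C₀ S]
    (dk : Derivation C₀ k k) (dS : Derivation C₀ S S)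
    (hdSk : ∀ a : k, dS (algebraMap k S a) = algebraMap k S (dk a))
    (A : Matrix (Fin n) (Fin n) k) (F : Matrix (Fin n) (Fin n) S)
    (hdF : ∀ i j, dS (F i j) = (A.map (algebraMap k S) * F) i j) (ν : ℕ)
    (v : MvPolynomial (Fin n × Fin n) S) (hv : v ∈ relationModule k F ν) :
    ∃ w ∈ relationModule k F ν, ∀ m, coeff m w = dS (coeff m v) := by
  induction hv using Submodule.span_induction with
  | mem x hx =>
    obtain ⟨P, ⟨hP, hPF⟩, rfl⟩ := hx
    obtain ⟨P', hP', hev, hcoeff⟩ := exists_derivative_substMatrix dk dS hdSk A F hdF P hP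
    exact ⟨_, Submodule.subset_span ⟨P', ⟨hP', by rw [hev, hPF, map_zero]⟩, rfl⟩, hcoeff⟩
  | zero => exact ⟨0, Submodule.zero_mem _, by simp⟩
  | add x y _ _ hx hy =>
    obtain ⟨x', hx', hx⟩ := hx
    obtain ⟨y', hy', hy⟩ := hy
    exact ⟨x' + y', Submodule.add_mem _ hx' hy', by simp [hx, hy]⟩
  | smul s x hxD hx =>
    obtain ⟨x', hx', hx⟩ := hx
    exact ⟨s • x' + dS s • x, Submodule.add_mem _ (Submodule.smul_mem _ _ hx')
      (Submodule.smul_mem _ _ hxD), fun m => by simp [hx, mul_comm]⟩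

/-- A point killing a set of polynomials kills the module generated by it. -/
theorem eval₂_eq_zero_of_mem_span (e : S →+* T) (x : σ → T) {s : Set (MvPolynomial σ S)}
    (hs : ∀ v ∈ s, eval₂ e x v = 0) (v : MvPolynomial σ S) (hv : v ∈ Submodule.span S s) :
    eval₂ e x v = 0 := by
  induction hv using Submodule.span_induction with
  | mem v hv => exact hs v hv
  | zero => simp
  | add v w _ _ hv hw => rw [eval₂_add, hv, hw, add_zero]
  | smul a v _ hv => rw [smul_eq_C_mul, eval₂_mul, hv, mul_zero]

end MvPolynomial

theorem GLRing_algHom_apply_algebraMap {k T : Type} [Field k] [CommRing T] [Algebra k T] {n : ℕ}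
    (f : GLRing k n →ₐ[k] T) (P : MvPolynomial (Fin n × Fin n) k) :
    f (algebraMap _ (GLRing k n) P) = aeval (fun p => f (XX k n p.1 p.2)) P := by
  have h := aeval_unique (f.comp (IsScalarTower.toAlgHom k (MvPolynomial (Fin n × Fin n) k) _))
  exact DFunLike.congr_fun h P

/-- An algebra map kills `I(F,ν)` as soon as it kills the generating polynomials. -/
theorem algHom_eq_zero_on_Ifv_iff {k S T : Type} [Field k] [CommRing S] [Algebra k S]
    [CommRing T] [Algebra k T] {n : ℕ} (ev : GLRing k n →ₐ[k] S) (f : GLRing k n →ₐ[k] T) (ν : ℕ) :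
    (∀ q ∈ Ifv ev ν, f q = 0) ↔ ∀ P : MvPolynomial (Fin n × Fin n) k, P.totalDegree ≤ ν →
      aeval (fun p => ev (XX k n p.1 p.2)) P = 0 →
      aeval (fun p => f (XX k n p.1 p.2)) P = 0 := by
  constructor
  · intro h P hP hPF
    rw [← GLRing_algHom_apply_algebraMap]
    exact h _ (Ideal.subset_span ⟨P, hP, by rw [GLRing_algHom_apply_algebraMap, hPF], rfl⟩)
  · intro h
    suffices hle : Ifv ev ν ≤ RingHom.ker f from fun q hq => hle hq
    refine Ideal.span_le.mpr ?_
    rintro _ ⟨P, hP, hPF, rfl⟩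
    rw [GLRing_algHom_apply_algebraMap] at hPF
    exact (GLRing_algHom_apply_algebraMap f P).trans (h P hP hPF)

/-- A substitution `X ↦ Xg` stabilizes `I(F,ν)` iff the generators of `I(F,ν)` vanish at `Fg`. -/
theorem mem_stab_Ifv_iff {C k S : Type} [Field C] [Field k] [CommRing S] [Algebra C k]
    [Algebra k S] [Algebra C S] [IsScalarTower C k S] {n : ℕ} (ev : GLRing k n →ₐ[k] S)
    (subst : GL (Fin n) C → (GLRing k n →ₐ[k] GLRing k n))
    (hsubst : ∀ (g : GL (Fin n) C) i j, subst g (XX k n i j)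
      = ∑ l, XX k n i l * algebraMap C (GLRing k n) ((g : Matrix (Fin n) (Fin n) C) l j))
    (ν : ℕ) (g : GL (Fin n) C) :
    g ∈ stab (fun g => (subst g : GLRing k n → GLRing k n)) (Ifv ev ν) ↔
      ∀ P : MvPolynomial (Fin n × Fin n) k, P.totalDegree ≤ ν →
        aeval (fun p => ev (XX k n p.1 p.2)) P = 0 →
        aeval (fun p => ((XX k n).map ev *
          (g : Matrix (Fin n) (Fin n) C).map (algebraMap C S)) p.1 p.2) P = 0 := by
  have hev_subst : ∀ i j, (ev.comp (subst g)) (XX k n i j) = ((XX k n).map ev *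
      (g : Matrix (Fin n) (Fin n) C).map (algebraMap C S)) i j := by
    intro i j
    rw [AlgHom.comp_apply, hsubst, map_sum, Matrix.mul_apply]
    refine Finset.sum_congr rfl fun l _ => ?_
    rw [map_mul, IsScalarTower.algebraMap_apply C k (GLRing k n), AlgHom.commutes,
      ← IsScalarTower.algebraMap_apply C k S]
    rfl
  simp only [← hev_subst]
  rw [← algHom_eq_zero_on_Ifv_iff ev (ev.comp (subst g)) ν]
  have hev0 : ∀ q ∈ Ifv ev ν, ev q = 0 :=
    (algHom_eq_zero_on_Ifv_iff ev ev ν).mpr fun _ _ h => h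
  refine ⟨fun hg q hq => hev0 _ (hg q hq), fun hg => ?_⟩
  suffices hle : Ifv ev ν ≤ (Ifv ev ν).comap (subst g) from fun q hq => hle hq
  refine Ideal.span_le.mpr ?_
  rintro _ ⟨P, hP, hPF, rfl⟩
  let f : Fin n × Fin n → MvPolynomial (Fin n × Fin n) k := fun p =>
    ∑ l, X (p.1, l) * MvPolynomial.C (algebraMap C k ((g : Matrix (Fin n) (Fin n) C) l p.2))
  have hf : subst g (algebraMap _ (GLRing k n) P) = algebraMap _ (GLRing k n) (aeval f P) := by
    refine (GLRing_algHom_apply_algebraMap (subst g) P).trans ?_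
    refine Eq.trans ?_ (comp_aeval_apply f (IsScalarTower.toAlgHom k _ (GLRing k n)) P).symm
    refine congrArg (fun y : Fin n × Fin n → GLRing k n => aeval (R := k) y P) (funext fun p => ?_)
    simp only [hsubst, f, map_sum, map_mul]
    refine Finset.sum_congr rfl fun l _ => ?_
    rw [IsScalarTower.algebraMap_apply C k (GLRing k n), ← algebraMap_eq, AlgHom.commutes]
    rfl
  refine Ideal.subset_span ⟨aeval f P, totalDegree_aeval_le_of_le_one (fun p => ?_) P hP, ?_, hf⟩
  · refine totalDegree_finsetSum_le fun l _ => (totalDegree_mul _ _).trans ?_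
    rw [totalDegree_C, totalDegree_X]
  · rw [← hf]
    exact hg _ (Ideal.subset_span ⟨P, hP, hPF, rfl⟩)

theorem statement6
    (C : Type) [Field C] [IsAlgClosed C] [CharZero C]
    (n : ℕ)
    -- the derivation δ = d/dt on k = C(t)
    (dk : Derivation C (RatFunc C) (RatFunc C)) (hdk : dk RatFunc.X = 1)
    (A : Matrix (Fin n) (Fin n) (RatFunc C))
    -- the derivation on k[X,1/det(X)] extending δ with δ(X) = AX
    (dR : Derivation C (GLRing (RatFunc C) n) (GLRing (RatFunc C) n))
    (hdRk : ∀ a : RatFunc C, dR (algebraMap (RatFunc C) (GLRing (RatFunc C) n) a)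
      = algebraMap (RatFunc C) (GLRing (RatFunc C) n) (dk a))
    (hdRX : ∀ i j, dR (XX (RatFunc C) n i j)
      = (A.map (algebraMap (RatFunc C) (GLRing (RatFunc C) n)) * XX (RatFunc C) n) i j)
    -- the Picard-Vessiot ring S of δ(Y) = AY over k, with fundamental matrix F
    (S : Type) [CommRing S] [Nontrivial S] [Algebra (RatFunc C) S] [Algebra C S]
    [IsScalarTower C (RatFunc C) S]
    (dS : Derivation C S S)
    (hdSk : ∀ a : RatFunc C, dS (algebraMap (RatFunc C) S a) = algebraMap (RatFunc C) S (dk a))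
    (F : Matrix (Fin n) (Fin n) S) (hF : IsUnit F.det)
    (hdF : ∀ i j, dS (F i j) = (A.map (algebraMap (RatFunc C) S) * F) i j)
    -- evaluation P(X) ↦ P(F)
    (ev : GLRing (RatFunc C) n →ₐ[RatFunc C] S)
    (hev : ∀ i j, ev (XX (RatFunc C) n i j) = F i j)
    (hevsurj : Function.Surjective ev)      -- S is generated by the entries of F and 1/det(F)
    (hsimple : ∀ J : Ideal S, J ≠ ⊤ → (∀ x ∈ J, dS x ∈ J) → J = ⊥)  -- S is δ-simple
    (hconst : ∀ s : S, dS s = 0 → ∃ c : C, s = algebraMap C S c)   -- constants of S are C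
    -- the substitution maps P(X) ↦ P(Xg) for g ∈ GL_n(C)
    (subst : GL (Fin n) C → (GLRing (RatFunc C) n →ₐ[RatFunc C] GLRing (RatFunc C) n))
    (hsubst : ∀ (g : GL (Fin n) C) i j, subst g (XX (RatFunc C) n i j)
      = ∑ l, XX (RatFunc C) n i l *
          algebraMap C (GLRing (RatFunc C) n) ((g : Matrix (Fin n) (Fin n) C) l j))
    -- the field K = k̄(F)
    (K : Type) [Field K] [Algebra (RatFunc C) K] [Algebra C K] [IsScalarTower C (RatFunc C) K]
    (ebar : AlgebraicClosure (RatFunc C) →ₐ[RatFunc C] K)   -- K contains k̄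
    (eS : S →ₐ[RatFunc C] K) (heS : Function.Injective eS)  -- K contains the entries of F
    (hKgen : ∀ L : Subfield K, (∀ x, ebar x ∈ L) → (∀ i j, eS (F i j) ∈ L) → L = ⊤)
    -- F viewed inside GL_n(K)
    (FK : GL (Fin n) K)
    (hFK : ∀ i j, (FK : Matrix (Fin n) (Fin n) K) i j = eS (F i j))
    -- evaluation maps P(X) ↦ P(M) for M ∈ GL_n(K)
    (evK : GL (Fin n) K → (GLRing (RatFunc C) n →ₐ[RatFunc C] K))
    (hevK : ∀ (M : GL (Fin n) K) i j,
      evK M (XX (RatFunc C) n i j) = (M : Matrix (Fin n) (Fin n) K) i j)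
    (ν : ℕ) :
    -- F · H(K) = V_K(I(F,ν)), where H = stab(I(F,ν))
    (fun h => FK * h) '' pts C K n
        (stab (fun g => (subst g : GLRing (RatFunc C) n → GLRing (RatFunc C) n)) (Ifv (⇑ev) ν))
      = zeroSet (fun M => (evK M : GLRing (RatFunc C) n → K)) (Ifv (⇑ev) ν) := by
  have hXXF : (XX (RatFunc C) n).map ev = F := Matrix.ext hev
  set H := stab (fun g => (subst g : GLRing (RatFunc C) n → GLRing (RatFunc C) n)) (Ifv (⇑ev) ν)
    with hH
  set D := relationModule (RatFunc C) F ν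
  let ι : S →+* K := eS
  have hιC : ι.comp (algebraMap C S) = algebraMap C K := by
    ext c
    rw [RingHom.comp_apply, IsScalarTower.algebraMap_apply C (RatFunc C) S,
      IsScalarTower.algebraMap_apply C (RatFunc C) K]
    exact eS.commutes _
  have hFKN : ∀ N : GL (Fin n) K, ((FK * N : GL (Fin n) K) : Matrix (Fin n) (Fin n) K)
      = F.map eS * (N : Matrix (Fin n) (Fin n) K) := by
    intro N
    rw [Units.val_mul]
    congr 1
    exact Matrix.ext hFK
  have hdescent : ∀ v ∈ D, v ∈ Submodule.span S {u | u ∈ D ∧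
      ∃ q : MvPolynomial (Fin n × Fin n) C, map (algebraMap C S) q = u} :=
    mem_span_constants_of_coeff_derivation dS hsimple hconst D
      (relationModule_derivation_stable dk dS hdSk A F hdF ν)
  -- the points of `F⁻¹ V_K(I)` and of `H` are those killing the module of relations
  have hzero : ∀ N : GL (Fin n) K,
      FK * N ∈ zeroSet (fun M => (evK M : GLRing (RatFunc C) n → K)) (Ifv (⇑ev) ν) ↔
        ∀ v ∈ D, eval₂ ι (fun p => (N : Matrix (Fin n) (Fin n) K) p.1 p.2) v = 0 := by
    intro N
    refine (algHom_eq_zero_on_Ifv_iff ev (evK (FK * N)) ν).trans ?_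
    simp only [hev, hevK, hFKN, ← eval₂_substMatrix]
    constructor
    · intro h
      refine eval₂_eq_zero_of_mem_span _ _ ?_
      rintro _ ⟨P, ⟨hP, hPF⟩, rfl⟩
      exact h P hP hPF
    · exact fun h P hP hPF => h _ (Submodule.subset_span ⟨P, ⟨hP, hPF⟩, rfl⟩)
  have hmemH : ∀ g : GL (Fin n) C, g ∈ H ↔ ∀ v ∈ D, eval₂ (RingHom.id S)
      (fun p => algebraMap C S ((g : Matrix (Fin n) (Fin n) C) p.1 p.2)) v = 0 := by
    intro g
    rw [hH, mem_stab_Ifv_iff ev subst hsubst, hXXF]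
    have h := eval₂_substMatrix F (AlgHom.id (RatFunc C) S)
      ((g : Matrix (Fin n) (Fin n) C).map (algebraMap C S))
    have hFid : F.map (AlgHom.id (RatFunc C) S) = F := Matrix.ext fun _ _ => rfl
    rw [hFid] at h
    simp only [hev, ← h]
    constructor
    · intro h
      refine eval₂_eq_zero_of_mem_span _ _ ?_
      rintro _ ⟨P, ⟨hP, hPF⟩, rfl⟩
      exact h P hP hPF
    · exact fun h P hP hPF => h _ (Submodule.subset_span ⟨P, ⟨hP, hPF⟩, rfl⟩)
  have hevalC : ∀ (x : Fin n × Fin n → C) (q : MvPolynomial (Fin n × Fin n) C),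
      eval₂ (RingHom.id S) (fun p => algebraMap C S (x p)) (map (algebraMap C S) q)
        = algebraMap C S (eval x q) := by
    intro x q
    rw [eval₂_map, RingHom.id_comp]
    exact (eval₂_comp (algebraMap C S) x q).symm
  have hpts : ∀ N : GL (Fin n) K, N ∈ pts C K n H ↔
      FK * N ∈ zeroSet (fun M => (evK M : GLRing (RatFunc C) n → K)) (Ifv (⇑ev) ν) := by
    intro N
    rw [hzero]
    constructor
    · intro hN v hv
      refine eval₂_eq_zero_of_mem_span _ _ ?_ v (hdescent v hv)
      rintro _ ⟨huD, q, rfl⟩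
      rw [eval₂_map, hιC]
      refine hN q fun h hh => ?_
      refine (algebraMap C S).injective ?_
      rw [← hevalC, map_zero]
      exact (hmemH h).mp hh _ huD
    · intro hN p hp
      let J : Ideal (MvPolynomial (Fin n × Fin n) C) :=
        Ideal.span {q | map (algebraMap C S) q ∈ D}
      have hJN : J ≤ RingHom.ker
          (aeval (fun p => (N : Matrix (Fin n) (Fin n) K) p.1 p.2) :
            MvPolynomial (Fin n × Fin n) C →ₐ[C] K) := by
        refine Ideal.span_le.mpr fun q hq => ?_
        have h := hN _ hq
        rwa [eval₂_map, hιC] at h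
      have hrad : p * (matX C n).det ∈ J.radical := by
        rw [← vanishingIdeal_zeroLocus_eq_radical (K := C), mem_vanishingIdeal_iff]
        intro x hx
        have hdet : aeval x (matX C n).det = (Matrix.of fun i j => x (i, j)).det := by
          rw [AlgHom.map_det]
          congr 1
          ext i j
          simp [matX]
        rw [map_mul, hdet]
        by_cases hx0 : (Matrix.of fun i j => x (i, j)).det = 0
        · rw [hx0, mul_zero]
        let g : GL (Fin n) C := Matrix.GeneralLinearGroup.mkOfDetNeZero _ hx0
        have hg : g ∈ H := by
          rw [hmemH]
          intro v hv
          refine eval₂_eq_zero_of_mem_span _ _ ?_ v (hdescent v hv)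
          rintro _ ⟨huD, q, rfl⟩
          rw [hevalC]
          have hq : aeval x q = 0 := hx q (Ideal.subset_span huD)
          exact (congrArg (algebraMap C S) hq).trans (map_zero _)
        have hpg : aeval x p = 0 := hp g hg
        rw [hpg, zero_mul]
      obtain ⟨m, hm⟩ := hrad
      have h0 := hJN hm
      rw [RingHom.mem_ker, map_pow, map_mul] at h0
      refine (mul_eq_zero.mp (eq_zero_of_pow_eq_zero h0)).resolve_right ?_
      have hdet : aeval (fun p => (N : Matrix (Fin n) (Fin n) K) p.1 p.2) (matX C n).det
          = (N : Matrix (Fin n) (Fin n) K).det := by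
        rw [AlgHom.map_det]
        congr 1
        ext i j
        simp [matX]
      rw [hdet]
      exact (Matrix.isUnits_det_units N).ne_zero
  ext M
  constructor
  · rintro ⟨N, hN, rfl⟩
    exact (hpts N).mp hN
  · intro hM
    exact ⟨FK⁻¹ * M, (hpts _).mpr (by rwa [mul_inv_cancel_left]), mul_inv_cancel_left _ _⟩
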